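/- arXiv:2106.03045 — 2 statements merged into one kernel-verified Lean document; each statement's English description precedes it below -/
import Mathlib

section
/- Let α, β ∈ ℝ with α ≠ 0. For the Lie algebra 𝔤₁ with its Bott connection ∇^B, the symmetrized Ricci tensor ρ̃^B of ∇^B is NOT a Codazzi tensor for ∇^B; that is, there exist X, Y, Z ∈ {e₁,e₂,e₃} with (∇^B_X ρ̃^B)(Y,Z) ≠ (∇^B_Y ρ̃^B)(X,Z). -/
noncomputable section

/-- The underlying vector space `V = ℝ³`. -/
abbrev V : Type := Fin 3 → ℝ

/-- The basis vector e₁. -/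
def e1 : V := ![1, 0, 0]
/-- The basis vector e₂. -/
def e2 : V := ![0, 1, 0]
/-- The basis vector e₃. -/
def e3 : V := ![0, 0, 1]

/-- The Lorentzian inner product with g(e₁,e₁)=g(e₂,e₂)=1, g(e₃,e₃)=−1. -/
def gL (x y : V) : ℝ := x 0 * y 0 + x 1 * y 1 - x 2 * y 2

/-- Curvature R(X,Y)Z = ∇_X ∇_Y Z − ∇_Y ∇_X Z − ∇_{[X,Y]} Z. -/
def curv (nabla bracket : V → V → V) (x y z : V) : V :=
  nabla x (nabla y z) - nabla y (nabla x z) - nabla (bracket x y) z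

/-- Ricci tensor ρ(X,Y) = −g(R(X,e₁)Y,e₁) − g(R(X,e₂)Y,e₂) + g(R(X,e₃)Y,e₃). -/
def ricci (nabla bracket : V → V → V) (x y : V) : ℝ :=
  - gL (curv nabla bracket x e1 y) e1 - gL (curv nabla bracket x e2 y) e2
  + gL (curv nabla bracket x e3 y) e3

/-- Symmetrized Ricci tensor ρ̃(X,Y) = (ρ(X,Y) + ρ(Y,X))/2. -/
def ricciSym (nabla bracket : V → V → V) (x y : V) : ℝ :=
  (ricci nabla bracket x y + ricci nabla bracket y x) / 2

/-- Covariant derivative of a (left-invariant) bilinear form: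
(∇_X ω)(Y,Z) = −ω(∇_X Y, Z) − ω(Y, ∇_X Z). -/
def covDer (nabla : V → V → V) (ω : V → V → ℝ) (x y z : V) : ℝ :=
  - ω (nabla x y) z - ω y (nabla x z)

/-- ω is a Codazzi tensor for ∇: (∇_X ω)(Y,Z) = (∇_Y ω)(X,Z) for all X,Y,Z. -/
def IsCodazzi (nabla : V → V → V) (ω : V → V → ℝ) : Prop :=
  ∀ x y z : V, covDer nabla ω x y z = covDer nabla ω y x z

/-- Torsion T(X,Y) = ∇_X Y − ∇_Y X − [X,Y]. -/
def torsion (nabla bracket : V → V → V) (x y : V) : V :=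
  nabla x y - nabla y x - bracket x y

/-- (V,∇,ω) is a quasi-statistical structure:
(∇_X ω)(Y,Z) − (∇_Y ω)(X,Z) + ω(T(X,Y),Z) = 0 for all X,Y,Z. -/
def IsQuasiStatistical (nabla bracket : V → V → V) (ω : V → V → ℝ) : Prop :=
  ∀ x y z : V,
    covDer nabla ω x y z - covDer nabla ω y x z + ω (torsion nabla bracket x y) z = 0

/-- The Lie bracket of the Lie algebra 𝔤1. -/
def bracket (α β : ℝ) (x y : V) : V :=
  ![ (x 0 * y 1 - x 1 * y 0) * (α) + (x 0 * y 2 - x 2 * y 0) * (-α) + (x 1 * y 2 - x 2 * y 1) * (β),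
     (x 0 * y 2 - x 2 * y 0) * (-β) + (x 1 * y 2 - x 2 * y 1) * (α),
     (x 0 * y 1 - x 1 * y 0) * (-β) + (x 1 * y 2 - x 2 * y 1) * (α) ]

/-- The Bott connection ∇^B of 𝔤1. -/
def nabla (α β : ℝ) (x y : V) : V :=
  ![ x 0 * y 1 * (α) + x 2 * y 0 * (α) + x 2 * y 1 * (-β),
     x 0 * y 0 * (-α) + x 2 * y 0 * (β) + x 2 * y 1 * (-α),
     x 1 * y 2 * (α) ]

/-- The Codazzi defect of `ρ̃^B` at `(e₃, e₁, e₁)` equals `3α³/2`. -/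
theorem covDer_ricciSym_e3_e1_e1_sub (α β : ℝ) :
    covDer (nabla α β) (ricciSym (nabla α β) (bracket α β)) e3 e1 e1 -
      covDer (nabla α β) (ricciSym (nabla α β) (bracket α β)) e1 e3 e1 = 3 / 2 * α ^ 3 := by
  simp [covDer, ricciSym, ricci, curv, gL, nabla, bracket, e1, e2, e3]
  ring

theorem stmt0 (α β : ℝ) (hα : α ≠ 0) :
    ∃ x ∈ ({e1, e2, e3} : Set V), ∃ y ∈ ({e1, e2, e3} : Set V),
      ∃ z ∈ ({e1, e2, e3} : Set V),
        covDer (nabla α β) (ricciSym (nabla α β) (bracket α β)) x y z ≠ covDer (nabla α β) (ricciSym (nabla α β) (bracket α β)) y x z := by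
  refine ⟨e3, by simp, e1, by simp, e1, by simp, fun h => hα ?_⟩
  have h_defect := covDer_ricciSym_e3_e1_e1_sub α β
  rw [h, sub_self] at h_defect
  simpa using h_defect.symm

end
end

section
/- Let α, β ∈ ℝ with α ≠ 0. For the Lie algebra 𝔤₁ with its Bott connection ∇^B and symmetrized Ricci tensor ρ̃^B, the triple (𝔤₁, ∇^B, ρ̃^B) is NOT a quasi-statistical structure; that is, there exist X, Y, Z ∈ {e₁,e₂,e₃} with (∇^B_X ρ̃^B)(Y,Z) − (∇^B_Y ρ̃^B)(X,Z) + ρ̃^B(T^B(X,Y), Z) ≠ 0. -/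
noncomputable section

theorem covDer_ricciSym_e1_e3_e1 (α β : ℝ) :
    covDer (nabla α β) (ricciSym (nabla α β) (bracket α β)) e1 e3 e1
      - covDer (nabla α β) (ricciSym (nabla α β) (bracket α β)) e3 e1 e1
      + ricciSym (nabla α β) (bracket α β) (torsion (nabla α β) (bracket α β) e1 e3) e1
      = -(3 / 2) * α ^ 3 := by
  simp [covDer, ricciSym, ricci, gL, curv, torsion, nabla, bracket, e1, e2, e3]
  ring

theorem stmt6 (α β : ℝ) (hα : α ≠ 0) :
    ∃ x ∈ ({e1, e2, e3} : Set V), ∃ y ∈ ({e1, e2, e3} : Set V),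
      ∃ z ∈ ({e1, e2, e3} : Set V),
        covDer (nabla α β) (ricciSym (nabla α β) (bracket α β)) x y z - covDer (nabla α β) (ricciSym (nabla α β) (bracket α β)) y x z
          + (ricciSym (nabla α β) (bracket α β)) (torsion (nabla α β) (bracket α β) x y) z ≠ 0 := by
  refine ⟨e1, by simp, e3, by simp, e1, by simp, ?_⟩
  rw [covDer_ricciSym_e1_e3_e1]
  exact mul_ne_zero (by norm_num) (pow_ne_zero 3 hα)

end
end
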